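/- arXiv:1907.05445 — 3 statements merged into one kernel-verified Lean document; each statement's English description precedes it below -/
import Mathlib

section
/- Let G be a finite connected distance-hereditary graph, let x and y be vertices of G, and let k be a non-negative integer. Then every vertex v in the slice S_k(x,y) is adjacent to every vertex of the next slice S_{k+1}(x,y); that is, consecutive interval slices of I(x,y) are completely joined. -/
/-- A graph is distance-hereditary if every connected induced subgraph is isometric
(equivalently, every induced path is a shortest path). -/
def DistHereditary {V : Type*} (G : SimpleGraph V) : Prop :=
  ∀ s : Set V, (G.induce s).Connected →
    ∀ u v : s, (G.induce s).dist u v = G.dist (u : V) (v : V)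

/-- Eccentricity of a vertex: `e(v) = max_{u} d(v,u)`. -/
noncomputable def ecc {V : Type*} [Fintype V] (G : SimpleGraph V) (v : V) : ℕ :=
  Finset.univ.sup (fun u => G.dist v u)

/-- Radius: minimum eccentricity. -/
noncomputable def rad {V : Type*} [Fintype V] (G : SimpleGraph V) : ℕ :=
  sInf (Set.range (ecc G))

/-- Diameter: maximum eccentricity. -/
noncomputable def diam {V : Type*} [Fintype V] (G : SimpleGraph V) : ℕ :=
  Finset.univ.sup (fun v => ecc G v)

/-- The center: vertices of minimum eccentricity. -/
def center {V : Type*} [Fintype V] (G : SimpleGraph V) : Set V :=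
  {v | ecc G v = rad G}

/-- Distance from a vertex to a set of vertices: `d(v,S) = min_{s ∈ S} d(v,s)`. -/
noncomputable def distToSet {V : Type*} (G : SimpleGraph V) (v : V) (S : Set V) : ℕ :=
  sInf ((G.dist v) '' S)

/-- The interval `I(x,y)`: vertices on shortest `(x,y)`-paths. -/
def interval {V : Type*} (G : SimpleGraph V) (x y : V) : Set V :=
  {v | G.dist x v + G.dist v y = G.dist x y}

/-- The intervalSlice `S_k(x,y) = {v ∈ I(x,y) : d(x,v) = k}`. -/
def intervalSlice {V : Type*} (G : SimpleGraph V) (x y : V) (k : ℕ) : Set V :=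
  {v | v ∈ interval G x y ∧ G.dist x v = k}

/-- The set `S` induces a cograph in `G`: no induced path on four vertices within `S`. -/
def IsCographOn {V : Type*} (G : SimpleGraph V) (S : Set V) : Prop :=
  ¬ ∃ a b c d : V, a ∈ S ∧ b ∈ S ∧ c ∈ S ∧ d ∈ S ∧
    a ≠ c ∧ a ≠ d ∧ b ≠ d ∧
    G.Adj a b ∧ G.Adj b c ∧ G.Adj c d ∧ ¬ G.Adj a c ∧ ¬ G.Adj a d ∧ ¬ G.Adj b d

/-- Every vertex of a shortest walk from `a` to `b` lies in the interval between `a` and `b`. -/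
lemma mem_interval_of_mem_support {V : Type*} {G : SimpleGraph V} {a b u : V}
    (hconn : G.Connected) (p : G.Walk a b) (hp : p.length = G.dist a b) (hu : u ∈ p.support) :
    u ∈ interval G a b := by
  classical
  have hlen := congrArg SimpleGraph.Walk.length (p.take_spec hu)
  rw [SimpleGraph.Walk.length_append] at hlen
  have h₁ := SimpleGraph.dist_le (p.takeUntil u hu)
  have h₂ := SimpleGraph.dist_le (p.dropUntil u hu)
  have h₃ := hconn.dist_triangle (u := a) (v := u) (w := b)
  simp only [interval, Set.mem_ofPred_eq]
  omega

/-- A vertex distinct from `b` has a neighbour one step closer to `b`. -/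
lemma exists_adj_dist_add_one_eq {V : Type*} {G : SimpleGraph V} (hconn : G.Connected)
    {a b : V} (hab : a ≠ b) : ∃ u, G.Adj a u ∧ G.dist u b + 1 = G.dist a b := by
  obtain ⟨p, hp⟩ := hconn.exists_walk_length_eq_dist a b
  cases p with
  | nil => exact absurd rfl hab
  | @cons _ u _ hadj q =>
    refine ⟨u, hadj, ?_⟩
    have h₁ := SimpleGraph.dist_le q
    have h₂ := hconn.dist_triangle (u := a) (v := u) (w := b)
    rw [SimpleGraph.dist_eq_one_iff_adj.mpr hadj] at h₂
    rw [SimpleGraph.Walk.length_cons] at hp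
    omega

/-- In a finite connected distance-hereditary graph, consecutive interval
slices are completely joined: every `v ∈ S_k(x,y)` is adjacent to every `w ∈ S_{k+1}(x,y)`. -/
theorem slices_joined {V : Type*} [Fintype V] (G : SimpleGraph V)
    (hconn : G.Connected) (hdh : DistHereditary G) (x y : V) (k : ℕ)
    (v w : V) (hv : v ∈ intervalSlice G x y k) (hw : w ∈ intervalSlice G x y (k + 1)) :
    G.Adj v w := by
  obtain ⟨hvI, hvk⟩ := hv
  obtain ⟨hwI, hwk⟩ := hw
  simp only [interval, Set.mem_ofPred_eq] at hvI hwI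
  obtain ⟨p, hp⟩ := hconn.exists_walk_length_eq_dist x v
  obtain ⟨q, hq⟩ := hconn.exists_walk_length_eq_dist x w
  obtain ⟨r, hr⟩ := hconn.exists_walk_length_eq_dist w y
  -- The only vertex of `s` in the slice at distance `k + 1` from `x` is `w`.
  let s : Set V := ({u | u ∈ p.support} ∪ {u | u ∈ q.support}) ∪ {u | u ∈ r.support}
  have hs : (G.induce s).Connected :=
    SimpleGraph.induce_union_connected
      (SimpleGraph.induce_union_connected p.connected_induce_support.preconnected
        q.connected_induce_support.preconnected
        ⟨x, p.start_mem_support, q.start_mem_support⟩).preconnected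
      r.connected_induce_support.preconnected ⟨w, Or.inr q.end_mem_support, r.start_mem_support⟩
  have hvs : v ∈ s := Or.inl (Or.inl p.end_mem_support)
  have hys : y ∈ s := Or.inr r.end_mem_support
  have hne : (⟨v, hvs⟩ : s) ≠ ⟨y, hys⟩ := by
    intro h
    obtain rfl : v = y := congrArg Subtype.val h
    rw [SimpleGraph.dist_self] at hvI
    omega
  obtain ⟨⟨u, hu⟩, hadj, hdist⟩ := exists_adj_dist_add_one_eq hs hne
  rw [hdh s hs, hdh s hs] at hdist
  simp only at hdist
  have htri := hconn.dist_triangle (u := x) (v := u) (w := y)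
  suffices u = w from this ▸ hadj
  rcases hu with (hu | hu) | hu
  · have h := mem_interval_of_mem_support hconn p hp hu
    simp only [interval, Set.mem_ofPred_eq] at h
    omega
  · have h := mem_interval_of_mem_support hconn q hq hu
    simp only [interval, Set.mem_ofPred_eq] at h
    exact hconn.dist_eq_zero_iff.mp (by omega)
  · have h := mem_interval_of_mem_support hconn r hr hu
    simp only [interval, Set.mem_ofPred_eq] at h
    exact (hconn.dist_eq_zero_iff.mp (by omega)).symm
end

section
/- Let G be a finite connected distance-hereditary graph. If a vertex x of G has eccentricity e(x) = rad(G) + 1, then d(x, C(G)) ≤ 2, i.e., x is within distance 2 of some central vertex of G. -/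
section

open SimpleGraph

/-- A vertex on a walk of length `d(u, v)` lies in the interval between `u` and `v`. -/
lemma dist_add_dist_le_of_mem_support {V : Type*} {G : SimpleGraph V} {u v w : V}
    (p : G.Walk u v) (hp : p.length = G.dist u v) (hw : w ∈ p.support) :
    G.dist u w + G.dist w v ≤ G.dist u v := by
  classical
  rw [← hp, ← p.take_spec hw, Walk.length_append]
  exact add_le_add (dist_le _) (dist_le _)

/-- Every slice `S_k(u, v)` with `k ≤ d(u, v)` is nonempty. -/
lemma exists_dist_eq_of_le_dist {V : Type*} {G : SimpleGraph V} (hconn : G.Connected)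
    {u v : V} {k : ℕ} (hk : k ≤ G.dist u v) :
    ∃ w, G.dist u w = k ∧ G.dist w v + k = G.dist u v := by
  obtain ⟨p, hp⟩ := hconn.exists_walk_length_eq_dist u v
  have htake := dist_le (p.take k)
  have hdrop := dist_le (p.drop k)
  have htri := hconn.dist_triangle (u := u) (v := p.getVert k) (w := v)
  rw [Walk.take_length] at htake
  rw [Walk.drop_length] at hdrop
  refine ⟨p.getVert k, ?_, ?_⟩ <;> omega

lemma dist_le_ecc {V : Type*} [Fintype V] (G : SimpleGraph V) (u v : V) :
    G.dist u v ≤ ecc G u :=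
  Finset.le_sup (f := fun v => G.dist u v) (Finset.mem_univ v)

lemma rad_le_ecc {V : Type*} [Fintype V] (G : SimpleGraph V) (v : V) : rad G ≤ ecc G v :=
  Nat.sInf_le ⟨v, rfl⟩

lemma distToSet_le_dist {V : Type*} {G : SimpleGraph V} {S : Set V} (u : V) {v : V}
    (hv : v ∈ S) : distToSet G u S ≤ G.dist u v :=
  Nat.sInf_le ⟨v, hv, rfl⟩

/-- If a walk in a distance-hereditary graph joins `x` to a vertex `b` at distance two, then
`x` and `b` have a common neighbour on the walk. -/
lemma DistHereditary.exists_common_neighbor_mem_support {V : Type*} {G : SimpleGraph V}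
    (hdh : DistHereditary G) {x b : V} (p : G.Walk x b) (hxb : G.dist x b = 2) :
    ∃ z ∈ p.support, G.Adj x z ∧ G.Adj z b := by
  have hc : (G.induce {v | v ∈ p.support}).Connected := p.connected_induce_support
  have hd := hdh _ hc ⟨x, p.start_mem_support⟩ ⟨b, p.end_mem_support⟩
  obtain ⟨z, hz, hzb⟩ := exists_dist_eq_of_le_dist hc (k := 1)
    (u := ⟨x, p.start_mem_support⟩) (v := ⟨b, p.end_mem_support⟩) (by simp only at hd; omega)
  refine ⟨z, z.2, ?_, ?_⟩
  · simpa using dist_eq_one_iff_adj.mp hz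
  · have hzb1 : (G.induce {v | v ∈ p.support}).dist z ⟨b, p.end_mem_support⟩ = 1 := by
      simp only at hd
      omega
    simpa using dist_eq_one_iff_adj.mp hzb1

/-- Let `w` be a neighbour of `x` on a shortest path to `c`. If `y` and `c` are joined outside
the closed neighbourhood of `x`, then `w` is also on a shortest path from `x` to `y`. -/
lemma DistHereditary.dist_lt_of_walk_avoiding {V : Type*} {G : SimpleGraph V}
    (hconn : G.Connected) (hdh : DistHereditary G) {x w c y : V}
    (hxw : G.Adj x w) (hwc : G.dist w c + 1 = G.dist x c) (q : G.Walk c y)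
    (hq : ∀ v ∈ q.support, 2 ≤ G.dist x v) : G.dist w y < G.dist x y := by
  obtain ⟨b, hxb, hby⟩ := exists_dist_eq_of_le_dist hconn (hq y q.end_mem_support)
  obtain ⟨p, hp⟩ := hconn.exists_walk_length_eq_dist w c
  obtain ⟨s, hs⟩ := hconn.exists_walk_length_eq_dist y b
  obtain ⟨z, hz, hxz, hzb⟩ := hdh.exists_common_neighbor_mem_support
    (Walk.cons hxw (p.append (q.append s))) hxb
  have hz1 := dist_eq_one_iff_adj.mpr hxz
  have hzw : z = w := by
    simp only [Walk.support_cons, List.mem_cons, Walk.mem_support_append_iff] at hz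
    rcases hz with rfl | hz | hz | hz
    · exact absurd hxz G.irrefl
    · have h := dist_add_dist_le_of_mem_support p hp hz
      have htri := hconn.dist_triangle (u := x) (v := z) (w := c)
      exact ((hconn.dist_eq_zero_iff (u := w) (v := z)).mp (by omega)).symm
    · have := hq z hz
      omega
    · have h := dist_add_dist_le_of_mem_support s hs hz
      have htri := hconn.dist_triangle (u := x) (v := z) (w := y)
      rw [dist_comm (u := y) (v := z), dist_comm (u := y) (v := b)] at h
      omega
  subst hzw
  have hzb1 := dist_eq_one_iff_adj.mpr hzb
  have htri := hconn.dist_triangle (u := z) (v := b) (w := y)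
  omega

end

/-- In a finite connected distance-hereditary graph, any vertex `x` with
`e(x) = rad(G) + 1` satisfies `d(x, C(G)) ≤ 2`. -/
theorem ecc_rad_succ_close_to_center {V : Type*} [Fintype V] (G : SimpleGraph V)
    (hconn : G.Connected) (hdh : DistHereditary G) (x : V)
    (hx : ecc G x = rad G + 1) :
    distToSet G x (center G) ≤ 2 := by
  by_contra! hfar
  have : Nonempty V := ⟨x⟩
  obtain ⟨c, hc⟩ : ∃ c, ecc G c = rad G := Nat.sInf_mem (Set.range_nonempty (ecc G))
  have hxc : 2 < G.dist x c := hfar.trans_le (distToSet_le_dist x hc)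
  obtain ⟨w, hxw, hwc⟩ := exists_dist_eq_of_le_dist hconn (k := 1) (by omega : 1 ≤ G.dist x c)
  suffices hw : ecc G w ≤ rad G by
    have := distToSet_le_dist (G := G) x (show w ∈ center G from hw.antisymm (rad_le_ecc G w))
    omega
  refine Finset.sup_le fun y _ => ?_
  have hwy := hconn.dist_triangle (u := w) (v := x) (w := y)
  rw [SimpleGraph.dist_comm (u := w) (v := x)] at hwy
  have hxy := dist_le_ecc G x y
  have hcy := dist_le_ecc G c y
  by_cases hnear : G.dist x y < rad G
  · omega
  obtain ⟨q, hq⟩ := hconn.exists_walk_length_eq_dist c y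
  have hadj := SimpleGraph.dist_eq_one_iff_adj.mp hxw
  have hlt := hdh.dist_lt_of_walk_avoiding hconn hadj hwc q fun v hv => by
    have h := dist_add_dist_le_of_mem_support q hq hv
    have h₁ := hconn.dist_triangle (u := x) (v := v) (w := c)
    have h₂ := hconn.dist_triangle (u := x) (v := v) (w := y)
    rw [SimpleGraph.dist_comm (u := v) (v := c)] at h₁
    omega
  omega
end

section
/- Let G be a finite connected distance-hereditary graph and let u,x,y be vertices with d(u,x) = d(u,y) and d(x,y) = 2k+1 for some integer k. Then every vertex s in the slice S_k(x,y) satisfies d(u,x) = d(u,s) + k. -/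
namespace SimpleGraph

variable {V : Type*} {G : SimpleGraph V}

lemma Walk.dist_getVert_getVert_le {x y : V} (P : G.Walk x y) {a b : ℕ} (hab : a ≤ b) :
    G.dist (P.getVert a) (P.getVert b) ≤ b - a := by
  have h := dist_le ((P.drop a).take (b - a))
  rw [Walk.take_length] at h
  rw [Walk.drop_getVert, Nat.add_sub_cancel' hab] at h
  exact h.trans (min_le_left _ _)

/-- Along a shortest walk, distances are differences of positions. -/
lemma Walk.dist_getVert_getVert (hconn : G.Connected) {x y : V} (P : G.Walk x y)
    (hP : P.length = G.dist x y) {a b : ℕ} (hab : a ≤ b) (hb : b ≤ P.length) :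
    G.dist (P.getVert a) (P.getVert b) = b - a := by
  have h₁ := P.dist_getVert_getVert_le (Nat.zero_le a)
  have h₂ := P.dist_getVert_getVert_le hab
  have h₃ := P.dist_getVert_getVert_le hb
  rw [P.getVert_zero] at h₁
  rw [P.getVert_length] at h₃
  have h₄ := hconn.dist_triangle (u := x) (v := P.getVert a) (w := y)
  have h₅ := hconn.dist_triangle (u := P.getVert a) (v := P.getVert b) (w := y)
  omega

/-- In a distance-hereditary graph, suppose a walk stays outside the ball of radius `d(u, p)`
around `u` and ends next to `p`. Then `p` lies on a shortest path from `u` to each vertex of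
the walk. -/
lemma dist_add_dist_of_adj_of_walk (hconn : G.Connected) (hdh : DistHereditary G)
    {u p x z : V} (W : G.Walk x z) (hW : ∀ v ∈ W.support, G.dist u p < G.dist u v)
    (hzp : G.Adj z p) {v : V} (hv : v ∈ W.support) :
    G.dist u p + G.dist p v = G.dist u v := by
  obtain ⟨R, hR⟩ := hconn.exists_walk_length_eq_dist p u
  let Q := W.append (Walk.cons hzp R)
  have hQ : ∀ t ∈ Q.support, t ∈ W.support ∨ t ∈ R.support := by
    intro t ht
    rw [Walk.mem_support_append_iff, Walk.support_cons, List.mem_cons] at ht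
    rcases ht with ht | rfl | ht
    · exact .inl ht
    · exact .inl W.end_mem_support
    · exact .inr ht
  have hvQ : v ∈ Q.support := Walk.mem_support_append_iff _ _ |>.2 (.inl hv)
  have hc := Q.connected_induce_support
  obtain ⟨T, hT⟩ := hc.exists_walk_length_eq_dist ⟨u, Q.end_mem_support⟩ ⟨v, hvQ⟩
  rw [hdh _ hc] at hT
  let T' : G.Walk u v := T.map (Embedding.induce _).toHom
  have hT' : T'.length = G.dist u v := (Walk.length_map _ _).trans hT
  have hlt := hW v hv
  have hmem : T'.getVert (G.dist u p) ∈ Q.support := by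
    have h : T'.getVert (G.dist u p) = T.getVert (G.dist u p) := Walk.getVert_map _ _ _
    exact h ▸ (T.getVert (G.dist u p)).2
  have hlevel : G.dist u (T'.getVert (G.dist u p)) = G.dist u p := by
    simpa using T'.dist_getVert_getVert hconn hT' (Nat.zero_le (G.dist u p)) (by omega)
  have hp : T'.getVert (G.dist u p) = p := by
    rcases hQ _ hmem with h | h
    · have := hW _ h
      omega
    · obtain ⟨n, hn, hnR⟩ := Walk.mem_support_iff_exists_getVert.1 h
      have h' := R.dist_getVert_getVert hconn hR hnR le_rfl
      rw [hn, R.getVert_length, dist_comm, hlevel, hR, dist_comm (u := p)] at h'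
      rw [hR, dist_comm] at hnR
      obtain rfl | hn0 : n = 0 ∨ G.dist u p = 0 := by omega
      · simpa using hn.symm
      · rw [hn0] at hlevel
        rw [hn0]
        simp [← hconn.dist_eq_zero_iff.1 hn0]
  have h := T'.dist_getVert_getVert hconn hT' (hlt.le.trans hT'.ge) le_rfl
  rw [hp, T'.getVert_length] at h
  omega

end SimpleGraph

/-- If `d(u,x) = d(u,y)` and `d(x,y) = 2k+1`, then every vertex
`s ∈ S_k(x,y)` satisfies `d(u,x) = d(u,s) + k`. -/
theorem slice_when_equidistant_to_odd_pair {V : Type*} [Fintype V] (G : SimpleGraph V)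
    (hconn : G.Connected) (hdh : DistHereditary G) (u x y s : V) (k : ℕ)
    (h1 : G.dist u x = G.dist u y) (h2 : G.dist x y = 2 * k + 1)
    (hs : s ∈ intervalSlice G x y k) :
    G.dist u x = G.dist u s + k := by
  obtain ⟨hsI, hsk⟩ := hs
  have hsI : G.dist x s + G.dist s y = G.dist x y := hsI
  obtain ⟨A, hA⟩ := hconn.exists_walk_length_eq_dist x s
  obtain ⟨B, hB⟩ := hconn.exists_walk_length_eq_dist s y
  obtain ⟨P, hP, hPs⟩ : ∃ P : G.Walk x y, P.length = G.dist x y ∧ P.getVert k = s :=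
    ⟨A.append B, by rw [SimpleGraph.Walk.length_append]; omega, by
      rw [SimpleGraph.Walk.getVert_append, if_neg (by omega), hA, hsk]; simp⟩
  have hlen : P.length = 2 * k + 1 := hP.trans h2
  -- `p` and `q` are the first and last positions on `P` closest to `u`.
  let level : ℕ → ℕ := fun n => G.dist u (P.getVert n)
  obtain ⟨m, hm, hmin⟩ := Finset.exists_min_image (Finset.range (2 * k + 2)) level ⟨0, by simp⟩
  let I := (Finset.range (2 * k + 2)).filter (fun n => level n = level m)
  have hI : I.Nonempty := ⟨m, by simp [I] at hm ⊢; exact hm⟩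
  obtain ⟨p, hpI, hpmin⟩ := Finset.exists_min_image I id hI
  obtain ⟨q, hqI, hqmax⟩ := Finset.exists_max_image I id hI
  have hpq : p ≤ q := hpmin q hqI
  simp only [I, Finset.mem_filter, Finset.mem_range, id] at hm hmin hpI hpmin hqI hqmax
  have hp : p + level m = G.dist u x := by
    rcases Nat.eq_zero_or_pos p with rfl | hpos
    · simpa [level] using hpI.2.symm
    · have hadj : G.Adj (P.getVert (p - 1)) (P.getVert p) := by
        simpa [Nat.sub_add_cancel hpos] using P.adj_getVert_succ (i := p - 1) (by omega)
      have h := SimpleGraph.dist_add_dist_of_adj_of_walk (u := u) hconn hdh (P.take (p - 1))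
        (fun v hv => by
          obtain ⟨n, rfl, -⟩ := SimpleGraph.Walk.mem_support_iff_exists_getVert.1 hv
          rw [SimpleGraph.Walk.take_getVert]
          have h₁ := hmin ((p - 1) ⊓ n) (by omega)
          have h₂ := mt (hpmin ((p - 1) ⊓ n)) (by omega)
          change level p < level ((p - 1) ⊓ n)
          omega) hadj (SimpleGraph.Walk.start_mem_support _)
      have h' := P.dist_getVert_getVert hconn hP (Nat.zero_le p) (by omega)
      rw [P.getVert_zero, SimpleGraph.dist_comm] at h'
      rw [h'] at h
      change level p + (p - 0) = _ at h
      omega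
  have hq : (2 * k + 1 - q) + level m = G.dist u y := by
    rcases (show q = 2 * k + 1 ∨ q < 2 * k + 1 by omega) with rfl | hlt
    · rw [← hqI.2]
      simp [level, ← hlen]
    · have hadj := (P.adj_getVert_succ (i := q) (by omega)).symm
      have h := SimpleGraph.dist_add_dist_of_adj_of_walk (u := u) hconn hdh
        (P.drop (q + 1)).reverse
        (fun v hv => by
          rw [SimpleGraph.Walk.support_reverse, List.mem_reverse] at hv
          obtain ⟨n, rfl, hn⟩ := SimpleGraph.Walk.mem_support_iff_exists_getVert.1 hv
          rw [SimpleGraph.Walk.drop_length] at hn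
          rw [SimpleGraph.Walk.drop_getVert]
          have h₁ := hmin (q + 1 + n) (by omega)
          have h₂ := mt (hqmax (q + 1 + n)) (by omega)
          change level q < level (q + 1 + n)
          omega) hadj (SimpleGraph.Walk.start_mem_support _)
      have h' := P.dist_getVert_getVert hconn hP (show q ≤ P.length by omega) le_rfl
      rw [P.getVert_length] at h'
      rw [h'] at h
      change level q + _ = _ at h
      omega
  have hdpq := P.dist_getVert_getVert hconn hP hpq (by omega)
  have hle : q - p ≤ 2 := by
    rcases Nat.eq_zero_or_pos (level m) with h0 | hpos
    · have hup := hconn.dist_eq_zero_iff.1 (hpI.2.trans h0)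
      have huq := hconn.dist_eq_zero_iff.1 (hqI.2.trans h0)
      rw [← hup, ← huq, SimpleGraph.dist_self] at hdpq
      omega
    · obtain ⟨R, hR⟩ := hconn.exists_walk_length_eq_dist (P.getVert p) u
      have hRl : R.length = level m := by rw [hR, SimpleGraph.dist_comm]; exact hpI.2
      have hadj := R.adj_getVert_succ (i := 0) (by omega)
      rw [R.getVert_zero, zero_add] at hadj
      have hw := R.dist_getVert_getVert hconn hR (show 1 ≤ R.length by omega) le_rfl
      rw [R.getVert_length, SimpleGraph.dist_comm] at hw
      have h := SimpleGraph.dist_add_dist_of_adj_of_walk (u := u) hconn hdh (P.drop p).reverse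
        (fun v hv => by
          rw [SimpleGraph.Walk.support_reverse, List.mem_reverse] at hv
          obtain ⟨n, rfl, hn⟩ := SimpleGraph.Walk.mem_support_iff_exists_getVert.1 hv
          rw [SimpleGraph.Walk.drop_length] at hn
          rw [SimpleGraph.Walk.drop_getVert]
          have h₁ := hmin (p + n) (by omega)
          change _ < level (p + n)
          omega) hadj (v := P.getVert q) (by
            rw [SimpleGraph.Walk.support_reverse, List.mem_reverse,
              SimpleGraph.Walk.mem_support_iff_exists_getVert]
            refine ⟨q - p, ?_, ?_⟩
            · rw [SimpleGraph.Walk.drop_getVert, Nat.add_sub_cancel' hpq]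
            · rw [SimpleGraph.Walk.drop_length]
              omega)
      have htri := hconn.dist_triangle (u := P.getVert p) (v := R.getVert 1) (w := P.getVert q)
      rw [SimpleGraph.dist_eq_one_iff_adj.2 hadj] at htri
      change _ = level q at h
      omega
  have hpk : p = k := by omega
  have hlevel : level p = level m := hpI.2
  rw [← hPs]
  change _ = level k + k
  rw [← hpk]
  omega
end
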